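/- arXiv:2311.09397 — 3 statements merged into one kernel-verified Lean document; each statement's English description precedes it below -/
import Mathlib

section
/- Mesh of induced partitions of the orbit space tends to zero: Let T be a forward expansive correspondence on a compact metric space (X,d) with expansive constant ε > 0, and let 𝒜 be a finite Borel partition of X with mesh(𝒜) < ε. Then lim_{n→∞} mesh(Ã_T^n) = 0, where the diameters of the elements of Ã_T^n are measured with respect to the metric d_ω on O_ω(T). -/
open Filter MeasureTheory Set
open scoped Topology ENNReal Classical

namespace Corr

variable {X : Type*}

/-- `T` is a correspondence on `X`: each `T x` is a nonempty closed subset of `X`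
and the graph `O₂(T)` is closed in `X × X`. -/
def IsCorrespondence [MetricSpace X] (T : X → Set X) : Prop :=
  (∀ x, (T x).Nonempty) ∧ (∀ x, IsClosed (T x)) ∧ IsClosed {p : X × X | p.2 ∈ T p.1}

/-- The graph `O₂(T) = {(x₁,x₂) : x₂ ∈ T x₁}`. -/
def graph2 (T : X → Set X) : Set (X × X) := {p | p.2 ∈ T p.1}

/-- The orbit space `O_ω(T)` (0-indexed sequences). -/
def orbitSpace (T : X → Set X) : Set (ℕ → X) := {x | ∀ k, x (k + 1) ∈ T (x k)}

/-- `x : Fin (n+1) → X` is an element of `O_{n+1}(T)`. -/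
def IsFinOrbit (T : X → Set X) {n : ℕ} (x : Fin (n + 1) → X) : Prop :=
  ∀ i : Fin n, x i.succ ∈ T (x i.castSucc)

/-- `O_{n+1}(T)` as a subset of `Fin (n+1) → X` (with the sup metric). -/
def finOrbits (T : X → Set X) (n : ℕ) : Set (Fin (n + 1) → X) := {x | IsFinOrbit T x}

/-- The first `n` entries of `x : ℕ → X` form an orbit in `O_n(T)`. -/
def IsOrbitSeg (T : X → Set X) (n : ℕ) (x : ℕ → X) : Prop :=
  ∀ i : ℕ, i + 1 < n → x (i + 1) ∈ T (x i)

/-- The shift on sequences. -/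
def shiftSeq : (ℕ → X) → ℕ → X := fun x k => x (k + 1)

/-- The shift `σ` on the orbit space `O_ω(T)`. -/
def shiftOrb (T : X → Set X) : ↥(orbitSpace T) → ↥(orbitSpace T) :=
  fun x => ⟨shiftSeq x.1, fun k => x.2 (k + 1)⟩

/-- The metric `d_ω` on sequences (`k`-th coordinate, `k ≥ 0`, has weight `2^{-(k+1)}`). -/
noncomputable def dOmega [MetricSpace X] (x y : ℕ → X) : ℝ :=
  ∑' k : ℕ, (1 / 2 : ℝ) ^ (k + 1) * (dist (x k) (y k) / (1 + dist (x k) (y k)))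

/-- `T` is forward expansive with expansive constant `ε`. -/
def IsFwdExpansiveWith [MetricSpace X] (T : X → Set X) (ε : ℝ) : Prop :=
  0 < ε ∧ ∀ x ∈ orbitSpace T, ∀ y ∈ orbitSpace T, x ≠ y → ∃ n : ℕ, ε < dist (x n) (y n)

/-- `T` is forward expansive. -/
def IsFwdExpansive [MetricSpace X] (T : X → Set X) : Prop :=
  ∃ ε : ℝ, IsFwdExpansiveWith T ε

/-- Extension by `0` of a potential `φ : O₂(T) → ℝ` to `X × X`. -/
noncomputable def ext2 (T : X → Set X) (φ : ↥(graph2 T) → ℝ) : X × X → ℝ :=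
  fun p => if h : p ∈ graph2 T then φ ⟨p, h⟩ else 0

/-- The Birkhoff sum `S_n φ` along an element of `X^{n+1}` (equal to the sum
`∑_{i=1}^n φ(x_i, x_{i+1})` on orbits in `O_{n+1}(T)`). -/
noncomputable def birkhoff (T : X → Set X) (φ : ↥(graph2 T) → ℝ) {n : ℕ}
    (x : Fin (n + 1) → X) : ℝ :=
  ∑ i : Fin n, ext2 T φ (x i.castSucc, x i.succ)

/-- `E` is `ε`-separated: distinct points of `E` are at distance `≥ ε`. -/
def eSep {Y : Type*} [PseudoMetricSpace Y] (ε : ℝ) (E : Set Y) : Prop :=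
  ∀ x ∈ E, ∀ y ∈ E, x ≠ y → ε ≤ dist x y

/-- `∑_{x ∈ E} exp (S_n φ (x))` for a set `E` of orbit segments. -/
noncomputable def orbSum (T : X → Set X) (φ : ↥(graph2 T) → ℝ) (n : ℕ)
    (E : Set (Fin (n + 1) → X)) : ℝ≥0∞ :=
  ∑' x : E, ENNReal.ofReal (Real.exp (birkhoff T φ (x : Fin (n + 1) → X)))

/-- Logarithm `ℝ≥0∞ → EReal`, with `log 0 = ⊥` and `log ⊤ = ⊤`. -/
noncomputable def elog (x : ℝ≥0∞) : EReal :=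
  if x = 0 then ⊥ else if x = ⊤ then ⊤ else ((Real.log x.toReal : ℝ) : EReal)

/-- `sup_E ∑_{x ∈ E} exp (S_n φ (x))` over `ε`-separated subsets `E` of `O_{n+1}(T)`. -/
noncomputable def sepSup [MetricSpace X] (T : X → Set X) (φ : ↥(graph2 T) → ℝ)
    (n : ℕ) (ε : ℝ) : ℝ≥0∞ :=
  ⨆ (E : Set (Fin (n + 1) → X)) (_ : E ⊆ finOrbits T n) (_ : eSep ε E), orbSum T φ n E

/-- `inf_F ∑_{x ∈ F} exp (S_n φ (x))` over `ε`-spanning subsets `F` of `O_{n+1}(T)`. -/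
noncomputable def spanInf [MetricSpace X] (T : X → Set X) (φ : ↥(graph2 T) → ℝ)
    (n : ℕ) (ε : ℝ) : ℝ≥0∞ :=
  ⨅ (E : Set (Fin (n + 1) → X)) (_ : E ⊆ finOrbits T n)
    (_ : ∀ y ∈ finOrbits T n, ∃ x ∈ E, dist x y < ε), orbSum T φ n E

/-- `limsup_n (1/n) log sup_E ∑_{x ∈ E} exp (S_n φ (x))` for a fixed `ε`. -/
noncomputable def pressSepEps [MetricSpace X] (T : X → Set X) (φ : ↥(graph2 T) → ℝ)
    (ε : ℝ) : EReal :=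
  Filter.limsup (fun n : ℕ => (((n : ℝ)⁻¹ : ℝ) : EReal) * elog (sepSup T φ n ε)) atTop

/-- The spanning-set analogue of `pressSepEps`. -/
noncomputable def pressSpanEps [MetricSpace X] (T : X → Set X) (φ : ↥(graph2 T) → ℝ)
    (ε : ℝ) : EReal :=
  Filter.limsup (fun n : ℕ => (((n : ℝ)⁻¹ : ℝ) : EReal) * elog (spanInf T φ n ε)) atTop

/-- The topological pressure `P(T,φ)` of a correspondence: the limit as `ε → 0⁺`
(equivalently, since `pressSepEps` is antitone in `ε`, the limsup) of
`limsup_n (1/n) log sup_E ∑_{x∈E} exp (S_nφ(x))` over `ε`-separated sets `E ⊆ O_{n+1}(T)`. -/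
noncomputable def pressure [MetricSpace X] (T : X → Set X) (φ : ↥(graph2 T) → ℝ) : EReal :=
  Filter.limsup (fun ε : ℝ => pressSepEps T φ ε) (𝓝[>] (0 : ℝ))

section MeasureTheoryDefs

variable [MeasurableSpace X]

/-- A transition probability kernel on `X`: a measurable assignment of probability
measures. -/
def IsTransKernel (Q : X → Measure X) : Prop :=
  Measurable Q ∧ ∀ x, IsProbabilityMeasure (Q x)

/-- The kernel `Q` is supported by the correspondence `T`. -/
def SupportedBy (T : X → Set X) (Q : X → Measure X) : Prop :=
  ∀ x, Q x (T x) = 1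

/-- `markovLaw μ Q n = μQ^{[n]}`, the law on `X^{n+1}` of the first `n+1` states of the
Markov chain with initial law `μ` and transition kernel `Q`. -/
noncomputable def markovLaw (μ : Measure X) (Q : X → Measure X) :
    (n : ℕ) → Measure (Fin (n + 1) → X)
  | 0 => μ.map fun x => fun _ : Fin 1 => x
  | n + 1 => (markovLaw μ Q n).bind fun x => (Q (x (Fin.last n))).map fun y => Fin.snoc x y

/-- `μQ^{[1]}` as a measure on `X × X`. -/
noncomputable def step2 (μ : Measure X) (Q : X → Measure X) : Measure (X × X) :=
  μ.bind fun x => (Q x).map fun y => (x, y)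

/-- `ν` is the law `μQ^ω` on `X^ℕ` of the full trajectory of the Markov chain with
initial law `μ` and transition kernel `Q`. -/
def IsTrajLaw (μ : Measure X) (Q : X → Measure X) (ν : Measure (ℕ → X)) : Prop :=
  IsProbabilityMeasure ν ∧
    ∀ n : ℕ, ν.map (fun x (i : Fin (n + 1)) => x i.val) = markovLaw μ Q n

end MeasureTheoryDefs

/-- The entropy `H_ν(𝒜)` of the finite measurable partition of `Y` given by the fibers
of `p : Y → I`. -/
noncomputable def partEntropy {Y : Type*} [MeasurableSpace Y] (ν : Measure Y)
    {I : Type*} [Fintype I] (p : Y → I) : ℝ :=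
  ∑ i : I, Real.negMulLog ((ν (p ⁻¹' {i})).toReal)

/-- The measure-theoretic entropy `h_μ(Q)` of a transition probability kernel:
`sup_𝒜 lim_n (1/n) H_{μQ^{[n-1]}}(𝒜ⁿ)` over finite measurable partitions `𝒜` of `X`. -/
noncomputable def kernelEntropy [MeasurableSpace X] (μ : Measure X) (Q : X → Measure X) :
    EReal :=
  ⨆ (m : ℕ) (p : X → Fin m) (_ : Measurable p),
    ((Filter.limsup
        (fun n : ℕ => (n : ℝ)⁻¹ * partEntropy (markovLaw μ Q (n - 1)) fun x => p ∘ x)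
        atTop : ℝ) : EReal)

/-- The Kolmogorov–Sinai entropy `h_ν(g)` of a measurable map `g`:
`sup_𝒫 lim_n (1/n) H_ν(⋁_{i<n} g^{-i}𝒫)` over finite measurable partitions `𝒫`. -/
noncomputable def ksEntropy {Y : Type*} [MeasurableSpace Y] (ν : Measure Y) (g : Y → Y) :
    EReal :=
  ⨆ (m : ℕ) (p : Y → Fin m) (_ : Measurable p),
    ((Filter.limsup
        (fun n : ℕ => (n : ℝ)⁻¹ * partEntropy ν fun y => fun i : Fin n => p (g^[i.val] y))
        atTop : ℝ) : EReal)

/-- The energy term `∫_X ∫_{T(x)} φ(x,y) dQ_x(y) dμ(x)`. -/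
noncomputable def energyInt [MeasurableSpace X] (T : X → Set X) (φ : ↥(graph2 T) → ℝ)
    (Q : X → Measure X) (μ : Measure X) : ℝ :=
  ∫ x, (∫ y in T x, ext2 T φ (x, y) ∂(Q x)) ∂μ

/-- `sup_{Q,μ} { h_μ(Q) + ∫∫ φ dQ dμ }` over transition probability kernels `Q`
supported by `T` and `Q`-invariant Borel probability measures `μ`. -/
noncomputable def varSup [MetricSpace X] [MeasurableSpace X] (T : X → Set X)
    (φ : ↥(graph2 T) → ℝ) : EReal :=
  ⨆ (Q : X → Measure X) (_ : IsTransKernel Q) (_ : SupportedBy T Q) (μ : Measure X)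
    (_ : IsProbabilityMeasure μ) (_ : μ.bind Q = μ),
    kernelEntropy μ Q + ((energyInt T φ Q μ : ℝ) : EReal)

/-- `(μ, Q)` is an equilibrium state for `T` and `φ`. -/
def IsEquilibrium [MetricSpace X] [MeasurableSpace X] (T : X → Set X) (φ : ↥(graph2 T) → ℝ)
    (μ : Measure X) (Q : X → Measure X) : Prop :=
  IsTransKernel Q ∧ SupportedBy T Q ∧ IsProbabilityMeasure μ ∧ μ.bind Q = μ ∧
    pressure T φ = kernelEntropy μ Q + ((energyInt T φ Q μ : ℝ) : EReal)

/-- `H(ρ) = -∑_y ρ{y} log ρ{y}` if `ρ` is supported on a countable set, `∞` otherwise. -/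
noncomputable def atomEntropy {Y : Type*} [MeasurableSpace Y] (ρ : Measure Y) : ℝ≥0∞ :=
  if ∃ A : Set Y, A.Countable ∧ MeasurableSet A ∧ ρ A = 1 then
    ∑' y : Y, ENNReal.ofReal (Real.negMulLog ((ρ {y}).toReal))
  else ⊤

/-- `R` is a backward conditional transition probability kernel of `ν` from `X₂` to `X₁`
supported on `M`. -/
def IsBackwardCondKernel {X₁ X₂ : Type*} [MeasurableSpace X₁] [MeasurableSpace X₂]
    (ν : Measure (X₁ × X₂)) (M : Set (X₁ × X₂)) (R : X₂ → Measure X₁) : Prop :=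
  Measurable R ∧ (∀ x, IsProbabilityMeasure (R x)) ∧
    (∀ x₂ ∈ Prod.snd '' M, R x₂ {x₁ | (x₁, x₂) ∈ M} = 1) ∧
    ∀ C : Set (X₁ × X₂), MeasurableSet C →
      ν C = ∫⁻ x₂, R x₂ {x₁ | (x₁, x₂) ∈ C} ∂(ν.map Prod.snd)

/-- `m(k) = ∑_{l<k} (m_l + p_l)`, the offsets in the specification property. -/
def specShift {n : ℕ} (m p : Fin n → ℕ) (k : ℕ) : ℕ :=
  ∑ l : Fin n, if l.val < k then m l + p l else 0

/-- The specification property for correspondences. -/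
def HasSpecification [MetricSpace X] (T : X → Set X) : Prop :=
  ∀ ε : ℝ, 0 < ε → ∃ M : ℕ, ∀ (n : ℕ) (m p : Fin n → ℕ) (x : Fin n → ℕ → X),
    (∀ j, 1 ≤ m j) → (∀ j, M < p j) → (∀ j, IsOrbitSeg T (m j) (x j)) →
    ∃ z ∈ orbitSpace T, ∀ j : Fin n, ∀ i < m j,
      dist (z (specShift m p j.val + i)) (x j i) < ε

/-- `φ` is Bowen summable w.r.t. the expansive constant `ε`, i.e.
`sup_n K_{φ,T}(ε,n) < ∞`. -/
def BowenSummableWith [MetricSpace X] (T : X → Set X) (φ : ↥(graph2 T) → ℝ) (ε : ℝ) : Prop :=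
  ∃ C : ℝ, ∀ (n : ℕ) (x y : Fin (n + 1) → X), IsFinOrbit T x → IsFinOrbit T y →
    (∀ k, dist (x k) (y k) < ε) → |birkhoff T φ x - birkhoff T φ y| ≤ C

/-- Forward image `T(A) = ⋃_{x ∈ A} T(x)`. -/
def corrImage (T : X → Set X) (A : Set X) : Set X := ⋃ x ∈ A, T x

/-- Iterated forward images `Tⁿ(A)`. -/
def corrIter (T : X → Set X) : ℕ → Set X → Set X
  | 0, A => A
  | n + 1, A => corrImage T (corrIter T n A)

/-- Backward image `T^{-1}(A) = {y : A ∩ T(y) ≠ ∅}`. -/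
def corrPre (T : X → Set X) (A : Set X) : Set X := {y | (A ∩ T y).Nonempty}

/-- Iterated backward images `T^{-n}(A)`. -/
def corrPreIter (T : X → Set X) : ℕ → Set X → Set X
  | 0, A => A
  | n + 1, A => corrPre T (corrPreIter T n A)

/-- `T` is an open correspondence. -/
def IsOpenCorr [MetricSpace X] (T : X → Set X) : Prop :=
  ∀ U : Set X, IsOpen U → IsOpen (corrImage T U)

/-- `T` is strongly transitive: `⋃_{n ≥ 1} T^{-n}(x)` is dense for every `x`. -/
def StronglyTransitive [MetricSpace X] (T : X → Set X) : Prop :=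
  ∀ x : X, Dense (⋃ n : ℕ, corrPreIter T (n + 1) {x})

/-- `T` is distance-expanding. -/
def DistanceExpanding [MetricSpace X] (T : X → Set X) : Prop :=
  ∃ lam : ℝ, 1 < lam ∧ ∃ η : ℝ, 0 < η ∧ ∃ n : ℕ, 1 ≤ n ∧
    ∀ x y : X, dist x y ≤ η →
      ∀ x' ∈ corrIter T n {x}, ∀ y' ∈ corrIter T n {y}, lam * dist x y ≤ dist x' y'

/-- `T` is topologically exact. -/
def TopologicallyExact [MetricSpace X] (T : X → Set X) : Prop :=
  ∀ U : Set X, IsOpen U → U.Nonempty → ∃ N : ℕ, 1 ≤ N ∧ corrIter T N U = Set.univ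

/-- `φ : O₂(T) → ℝ` is Hölder continuous w.r.t. the metric
`d₂((x₁,x₂),(y₁,y₂)) = max (d x₁ y₁) (d x₂ y₂)` (the product metric on `X × X`). -/
def HolderOn [MetricSpace X] (T : X → Set X) (φ : ↥(graph2 T) → ℝ) : Prop :=
  ∃ C : ℝ, 0 < C ∧ ∃ α : ℝ, 0 < α ∧ α ≤ 1 ∧
    ∀ a b : ↥(graph2 T), |φ a - φ b| ≤ C * dist (a : X × X) (b : X × X) ^ α

/-- `O_{-n}(x)`: backward orbits of length `n+1` terminating at `x`. -/
def backOrbits (T : X → Set X) (n : ℕ) (x : X) : Set (Fin (n + 1) → X) :=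
  {y | IsFinOrbit T y ∧ y (Fin.last n) = x}

/-- The lift `φ̃(x₁,x₂,…) = φ(x₁,x₂)` of a potential to the orbit space. -/
def liftPhi (T : X → Set X) (φ : ↥(graph2 T) → ℝ) : ↥(orbitSpace T) → ℝ :=
  fun x => φ ⟨(x.1 0, x.1 1), x.2 0⟩

/-- The Ruelle operator `L_{φ̃}` for the shift on the orbit space:
`(L_{φ̃} Φ)(x) = ∑_{σ(y)=x} Φ(y) exp(φ̃(y))`. -/
noncomputable def ruelleL (T : X → Set X) (φ : ↥(graph2 T) → ℝ)
    (Φ : ↥(orbitSpace T) → ℝ) : ↥(orbitSpace T) → ℝ :=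
  fun x => ∑ᶠ (y : ↥(orbitSpace T)) (_ : shiftOrb T y = x), Φ y * Real.exp (liftPhi T φ y)

/-- Classical topological pressure of a map `g : Y → Y` w.r.t. a potential `ψ` and an
explicit distance function `ρ`, via `(n,ε)`-separated sets. -/
noncomputable def dynPressure {Y : Type*} (ρ : Y → Y → ℝ) (g : Y → Y) (ψ : Y → ℝ) : EReal :=
  Filter.limsup (fun ε : ℝ =>
    Filter.limsup (fun n : ℕ => (((n : ℝ)⁻¹ : ℝ) : EReal) * elog
      (⨆ (E : Set Y) (_ : ∀ x ∈ E, ∀ y ∈ E, x ≠ y → ∃ j < n, ε ≤ ρ (g^[j] x) (g^[j] y)),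
        ∑' x : E, ENNReal.ofReal (Real.exp (∑ j ∈ Finset.range n, ψ (g^[j] (x : Y))))))
      atTop) (𝓝[>] (0 : ℝ))

end Corr
namespace Corr

theorem isClosed_orbitSpace [TopologicalSpace X] {T : X → Set X}
    (hT : IsClosed {q : X × X | q.2 ∈ T q.1}) : IsClosed (orbitSpace T) := by
  simp only [orbitSpace, ofPred_forall]
  exact isClosed_iInter fun k =>
    hT.preimage (f := fun x : ℕ → X => (x k, x (k + 1))) (by fun_prop)

theorem dOmega_self [MetricSpace X] (x : ℕ → X) : dOmega x x = 0 := by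
  simp [dOmega]

theorem dOmega_nonneg [MetricSpace X] (x y : ℕ → X) : 0 ≤ dOmega x y :=
  tsum_nonneg fun k => by positivity

theorem continuous_dOmega [MetricSpace X] :
    Continuous fun q : (ℕ → X) × (ℕ → X) => dOmega q.1 q.2 := by
  unfold dOmega
  refine continuous_tsum (u := fun k : ℕ => (1 / 2 : ℝ) ^ (k + 1)) (fun k => ?_) ?_ ?_
  · refine continuous_const.mul (Continuous.div (by fun_prop) (by fun_prop) fun q => ?_)
    positivity
  · exact (summable_nat_add_iff 1).2 summable_geometric_two
  · intro k q
    rw [Real.norm_of_nonneg (by positivity)]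
    refine mul_le_of_le_one_right (by positivity) ?_
    exact div_le_one_of_le₀ (by linarith) (by positivity)

/-- For an expansive correspondence, orbits that stay `ε`-close for long enough are uniformly
`d_ω`-close. -/
theorem exists_forall_dOmega_lt [MetricSpace X] [CompactSpace X] {T : X → Set X}
    (hT : IsCorrespondence T) {ε : ℝ} (hexp : IsFwdExpansiveWith T ε) {δ : ℝ} (hδ : 0 < δ) :
    ∃ N : ℕ, ∀ x ∈ orbitSpace T, ∀ y ∈ orbitSpace T,
      (∀ i < N, dist (x i) (y i) ≤ ε) → dOmega x y < δ := by
  have hO := isClosed_orbitSpace hT.2.2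
  let K : Set ((ℕ → X) × (ℕ → X)) := orbitSpace T ×ˢ orbitSpace T ∩ {q | δ ≤ dOmega q.1 q.2}
  let C : ℕ → Set ((ℕ → X) × (ℕ → X)) := fun n => {q | ∀ i < n, dist (q.1 i) (q.2 i) ≤ ε}
  have hK : IsCompact K :=
    ((hO.prod hO).inter (isClosed_le continuous_const continuous_dOmega)).isCompact
  have hC (n : ℕ) : IsClosed (C n) := by
    have : C n = ⋂ i, ⋂ (_ : i < n), {q | dist (q.1 i) (q.2 i) ≤ ε} := by
      ext q; simp [C]
    rw [this]
    exact isClosed_iInter fun i => isClosed_iInter fun _ =>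
      isClosed_le (by fun_prop) continuous_const
  have hanti : Antitone C := fun a b hab q hq i hi => hq i (hi.trans_le hab)
  have hempty : K ∩ ⋂ n, C n = ∅ := by
    refine eq_empty_of_forall_notMem ?_
    rintro ⟨x, y⟩ ⟨⟨⟨hx, hy⟩, hxy⟩, hc⟩
    have hclose (i : ℕ) : dist (x i) (y i) ≤ ε := mem_iInter.1 hc (i + 1) i i.lt_succ_self
    have hne : x ≠ y := by
      rintro rfl
      exact absurd (show δ ≤ dOmega x x from hxy) (by simpa [dOmega_self] using hδ)
    obtain ⟨n, hn⟩ := hexp.2 x hx y hy hne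
    exact (hclose n).not_gt hn
  obtain ⟨N, hN⟩ := hK.elim_directed_family_closed C hC hempty hanti.directed_ge
  refine ⟨N, fun x hx y hy h => lt_of_not_ge fun hxy => ?_⟩
  exact (hN.subset (⟨⟨⟨hx, hy⟩, hxy⟩, h⟩ : (x, y) ∈ K ∩ C N)).elim

/-- The mesh (w.r.t. `d_ω`) of the partitions `Ã_T^n` of the orbit space induced by a
finite Borel partition of `X` of mesh less than an expansive constant tends to `0`. -/
theorem mesh_tendsto_zero
    {X : Type*} [MetricSpace X] [CompactSpace X] [MeasurableSpace X] [BorelSpace X]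
    (T : X → Set X) (hT : IsCorrespondence T) {ε : ℝ} (hexp : IsFwdExpansiveWith T ε)
    {m : ℕ} (p : X → Fin m) (hp : Measurable p)
    (hmesh : ∀ j : Fin m, Metric.diam (p ⁻¹' {j}) < ε) :
    Tendsto (fun n : ℕ =>
        sSup {r : ℝ | ∃ x ∈ orbitSpace T, ∃ y ∈ orbitSpace T,
          (∀ i < n, p (x i) = p (y i)) ∧ r = dOmega x y})
      atTop (𝓝 0) := by
  rw [Metric.tendsto_atTop]
  intro δ hδ
  obtain ⟨N, hN⟩ := exists_forall_dOmega_lt hT hexp (half_pos hδ)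
  refine ⟨N, fun n hn => ?_⟩
  rw [Real.dist_0_eq_abs, abs_of_nonneg]
  · refine lt_of_le_of_lt (Real.sSup_le ?_ (half_pos hδ).le) (half_lt_self hδ)
    rintro r ⟨x, hx, y, hy, hxy, rfl⟩
    refine (hN x hx y hy fun i hi => ?_).le
    exact (Metric.dist_le_diam_of_mem (isCompact_univ.isBounded.subset (subset_univ _))
      (show x i ∈ p ⁻¹' {p (y i)} from hxy i (hi.trans_le hn)) rfl).trans (hmesh _).le
  · refine Real.sSup_nonneg ?_
    rintro r ⟨x, -, y, -, -, rfl⟩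
    exact dOmega_nonneg x y

end Corr
end

section
/- Lebesgue differentiation along induced partitions of the orbit space: Let T be a forward expansive correspondence on a compact metric space (X,d) with expansive constant ε > 0, let 𝒜 be a finite Borel partition of X with mesh(𝒜) < ε, let ν be a Borel probability measure on O_ω(T), and let f : O_ω(T) → ℝ be a bounded Borel measurable function. Then for ν-almost every x ∈ O_ω(T): (i) ν(Ã_T^n(x)) > 0 for all n ∈ ℕ; (ii) the limit lim_{n→∞} (1/ν(Ã_T^n(x))) ∫_{Ã_T^n(x)} f dν exists and equals f(x). -/
open Filter MeasureTheory Set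
open scoped Topology ENNReal Classical

namespace Corr

/-- Almost every point lies in a fibre of positive measure of a given map to a countable type. -/
lemma ae_measure_fiber_pos {Ω ι : Type*} [MeasurableSpace Ω] [Countable ι]
    (μ : Measure Ω) (g : Ω → ι) : ∀ᵐ x ∂μ, 0 < μ (g ⁻¹' {g x}) := by
  have h : ∀ i : ι, ∀ᵐ x ∂μ, g x = i → 0 < μ (g ⁻¹' {i}) := by
    intro i
    by_cases hi : μ (g ⁻¹' {i}) = 0
    · filter_upwards [measure_eq_zero_iff_ae_notMem.1 hi] with x hx hxi
      exact absurd hxi hx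
    · exact Eventually.of_forall fun _ _ => pos_iff_ne_zero.2 hi
  filter_upwards [ae_all_iff.2 h] with x hx using hx _ rfl

/-- On a fibre of positive measure, the conditional expectation given a discrete random variable
is the average over the fibre. -/
lemma condExp_comap_eq_average {Ω ι : Type*} [mΩ : MeasurableSpace Ω] [MeasurableSpace ι]
    [MeasurableSingletonClass ι] (μ : Measure Ω) [IsFiniteMeasure μ]
    {g : Ω → ι} (hg : Measurable g) {f : Ω → ℝ} (hf : Integrable f μ) {x : Ω}
    (hx : 0 < μ (g ⁻¹' {g x})) :
    (μ[f | MeasurableSpace.comap g inferInstance]) x =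
      (∫ y in g ⁻¹' {g x}, f y ∂μ) / (μ (g ⁻¹' {g x})).toReal := by
  have hconst : ∀ y ∈ g ⁻¹' {g x}, (μ[f | MeasurableSpace.comap g inferInstance]) y =
      (μ[f | MeasurableSpace.comap g inferInstance]) x := by
    intro y hy
    obtain ⟨s, -, hs⟩ := (stronglyMeasurable_condExp (μ := μ) (f := f)
      (m := MeasurableSpace.comap g inferInstance)).measurable
        (measurableSet_singleton ((μ[f | MeasurableSpace.comap g inferInstance]) x))
    have hxs : x ∈ g ⁻¹' s := by rw [hs]; rfl
    have hys : y ∈ g ⁻¹' s := by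
      have h : g y = g x := hy
      simpa only [mem_preimage, h] using hxs
    rw [hs] at hys
    exact hys
  have hint := setIntegral_condExp hg.comap_le hf
    (s := g ⁻¹' {g x}) ⟨{g x}, measurableSet_singleton _, rfl⟩
  rw [setIntegral_congr_fun (hg (measurableSet_singleton _)) hconst, setIntegral_const,
    smul_eq_mul] at hint
  rw [← hint]
  have hne : μ.real (g ⁻¹' {g x}) ≠ 0 :=
    (ENNReal.toReal_pos hx.ne' (measure_ne_top _ _)).ne'
  exact (mul_div_cancel_left₀ _ hne).symm

lemma isClosed_orbitSpace_s13 {X : Type*} [MetricSpace X] {T : X → Set X}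
    (hT : IsCorrespondence T) : IsClosed (orbitSpace T) := by
  have h : orbitSpace T =
      ⋂ k : ℕ, (fun x : ℕ → X => (x k, x (k + 1))) ⁻¹' {q : X × X | q.2 ∈ T q.1} := by
    ext x
    simp [orbitSpace]
  rw [h]
  exact isClosed_iInter fun k => hT.2.2.preimage (by fun_prop)

/-- Itineraries with respect to a partition of mesh less than an expansive constant determine
orbits. -/
lemma injective_itinerary {X ι : Type*} [MetricSpace X] [CompactSpace X] {T : X → Set X} {ε : ℝ}
    (hexp : IsFwdExpansiveWith T ε) {p : X → ι} (hmesh : ∀ j, Metric.diam (p ⁻¹' {j}) < ε) :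
    Function.Injective fun (x : orbitSpace T) (i : ℕ) => p (x.1 i) := by
  intro x y hxy
  by_contra hne
  obtain ⟨n, hn⟩ := hexp.2 x x.2 y y.2 fun h => hne (Subtype.ext h)
  have hp : p (x.1 n) = p (y.1 n) := congrFun hxy n
  have hd := Metric.dist_le_diam_of_mem (s := p ⁻¹' {p (y.1 n)})
    (isCompact_univ.isBounded.subset (subset_univ _)) hp rfl
  exact lt_asymm hn (hd.trans_lt (hmesh _))

/-- The filtration generated by the first `n` coordinates of a sequence of maps. -/
def initialFiltration {Ω ι : Type*} [MeasurableSpace Ω] [MeasurableSpace ι] (c : Ω → ℕ → ι)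
    (hc : Measurable c) : Filtration ℕ (inferInstance : MeasurableSpace Ω) where
  seq n := MeasurableSpace.comap (fun x (i : Fin n) => c x i) inferInstance
  mono' a b hab := by
    have h : (fun x (i : Fin a) => c x i) =
        (fun (u : Fin b → ι) (i : Fin a) => u (Fin.castLE hab i)) ∘
          fun x (i : Fin b) => c x i := rfl
    change MeasurableSpace.comap _ _ ≤ MeasurableSpace.comap _ _
    rw [h, ← MeasurableSpace.comap_comp]
    exact MeasurableSpace.comap_mono (Measurable.comap_le (by fun_prop))
  le' n := Measurable.comap_le (by fun_prop)

lemma comap_le_iSup_initialFiltration {Ω ι : Type*} [MeasurableSpace Ω] [MeasurableSpace ι]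
    (c : Ω → ℕ → ι) (hc : Measurable c) :
    MeasurableSpace.comap c inferInstance ≤ ⨆ n, initialFiltration c hc n := by
  refine Measurable.comap_le (@measurable_pi_lambda _ _ _ (_) _ _ fun i => ?_)
  refine Measurable.mono (ma := initialFiltration c hc (i + 1)) ?_
    (le_iSup (fun n => initialFiltration c hc n) (i + 1)) le_rfl
  exact (measurable_pi_apply (Fin.last i)).comp
    (comap_measurable fun x (j : Fin (i + 1)) => c x j)

/-- Lebesgue differentiation along the induced partitions `Ã_T^n` of the orbit space:
for `ν`-a.e. `x ∈ O_ω(T)`, each cell `Ã_T^n(x)` has positive measure and the averages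
of a bounded Borel function `f` over `Ã_T^n(x)` converge to `f(x)`. -/
theorem lebesgue_points_orbit_partitions
    {X : Type*} [MetricSpace X] [CompactSpace X] [MeasurableSpace X] [BorelSpace X]
    (T : X → Set X) (hT : IsCorrespondence T) {ε : ℝ} (hexp : IsFwdExpansiveWith T ε)
    {m : ℕ} (p : X → Fin m) (hp : Measurable p)
    (hmesh : ∀ j : Fin m, Metric.diam (p ⁻¹' {j}) < ε)
    (ν : Measure ↥(orbitSpace T)) (hν : IsProbabilityMeasure ν)
    (f : ↥(orbitSpace T) → ℝ) (hmf : Measurable f) (hbf : ∃ C : ℝ, ∀ x, |f x| ≤ C) :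
    ∀ᵐ x ∂ν,
      (∀ n : ℕ, 0 < ν {y : ↥(orbitSpace T) | ∀ i < n, p (y.1 i) = p (x.1 i)}) ∧
      Tendsto (fun n : ℕ =>
          (∫ y in {y : ↥(orbitSpace T) | ∀ i < n, p (y.1 i) = p (x.1 i)}, f y ∂ν) /
            (ν {y : ↥(orbitSpace T) | ∀ i < n, p (y.1 i) = p (x.1 i)}).toReal)
        atTop (𝓝 (f x)) := by
  obtain ⟨C, hC⟩ := hbf
  have hf : Integrable f ν :=
    Integrable.of_bound hmf.aestronglyMeasurable C (Eventually.of_forall hC)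
  set c : orbitSpace T → ℕ → Fin m := fun x i => p (x.1 i) with hc_def
  have hc : Measurable c := measurable_pi_lambda _ fun i =>
    hp.comp ((measurable_pi_apply i).comp measurable_subtype_coe)
  have : StandardBorelSpace (orbitSpace T) :=
    (isClosed_orbitSpace_s13 hT).measurableSet.standardBorel
  have hemb : MeasurableEmbedding c := hc.measurableEmbedding (injective_itinerary hexp hmesh)
  have hmeas : StronglyMeasurable[⨆ n, initialFiltration c hc n] f :=
    (hmf.mono (hemb.comap_eq.ge.trans (comap_le_iSup_initialFiltration c hc))
      le_rfl).stronglyMeasurable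
  have hset : ∀ (x : orbitSpace T) (n : ℕ), {y : orbitSpace T | ∀ i < n, p (y.1 i) = p (x.1 i)} =
      (fun z (i : Fin n) => c z i) ⁻¹' {fun i : Fin n => c x i} := by
    intro x n
    ext y
    simp [hc_def, funext_iff, Fin.forall_iff]
  filter_upwards [hf.tendsto_ae_condExp hmeas, ae_all_iff.2 fun n : ℕ =>
    ae_measure_fiber_pos ν fun z (i : Fin n) => c z i] with x hlim hpos
  simp only [hset]
  refine ⟨hpos, hlim.congr fun n => ?_⟩
  exact condExp_comap_eq_average ν (by fun_prop) hf (hpos n)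

end Corr
end

section
/- Rokhlin formula for the shift on the orbit space: Let T be a forward expansive correspondence on a compact metric space (X,d), let ν be a σ-invariant Borel probability measure on O_ω(T), let ν̂ be the Borel probability measure on X^ℕ defined by ν̂(A) := ν(A ∩ O_ω(T)), and let 𝒫 be a backward conditional transition probability kernel of ν̂ from X^ℕ to X supported on O₂(T)×X^ℕ (here X^ℕ is identified with X×X^ℕ via (x₀,x₁,x₂,…) ↔ (x₀,(x₁,x₂,…)), and O₂(T)×X^ℕ = {(x₀,x₁,x₂,…) ∈ X^ℕ : x₁ ∈ T(x₀)}). Then h_ν(σ) = ∫_{O_ω(T)} H(𝒫_x) dν(x), where h_ν(σ) is the Kolmogorov–Sinai entropy of the shift σ on O_ω(T) with respect to ν. -/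
open Filter MeasureTheory Set
open scoped Topology ENNReal Classical

namespace Corr

section CondFreq

variable {Y I J : Type*} [MeasurableSpace Y]

/-- The conditional probability of `p = i` given `q = j`. -/
noncomputable def condFreq (ν : Measure Y) (p : Y → I) (q : Y → J) (i : I) (j : J) : ℝ :=
  ν.real (p ⁻¹' {i} ∩ q ⁻¹' {j}) / ν.real (q ⁻¹' {j})

theorem condFreq_nonneg (ν : Measure Y) (p : Y → I) (q : Y → J) (i : I) (j : J) :
    0 ≤ condFreq ν p q i j := div_nonneg measureReal_nonneg measureReal_nonneg

theorem condFreq_le_one (ν : Measure Y) [IsFiniteMeasure ν] (p : Y → I) (q : Y → J)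
    (i : I) (j : J) : condFreq ν p q i j ≤ 1 :=
  div_le_one_of_le₀ (measureReal_mono inter_subset_right) measureReal_nonneg

theorem real_mul_condFreq (ν : Measure Y) [IsFiniteMeasure ν] (p : Y → I) (q : Y → J)
    (i : I) (j : J) :
    ν.real (q ⁻¹' {j}) * condFreq ν p q i j = ν.real (p ⁻¹' {i} ∩ q ⁻¹' {j}) := by
  rcases eq_or_ne (ν.real (q ⁻¹' {j})) 0 with h | h
  · have : ν.real (p ⁻¹' {i} ∩ q ⁻¹' {j}) = 0 :=
      le_antisymm (h ▸ measureReal_mono inter_subset_right) measureReal_nonneg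
    simp [h, this]
  · rw [condFreq, mul_div_cancel₀ _ h]

end CondFreq

section FinitePartitions

variable {Y I J : Type*} [MeasurableSpace Y] [Fintype I] [Fintype J]

theorem partEntropy_eq_sum_real (ν : Measure Y) (p : Y → I) :
    partEntropy ν p = ∑ i, Real.negMulLog (ν.real (p ⁻¹' {i})) := rfl

theorem partEntropy_equiv (ν : Measure Y) (e : I ≃ J) (p : Y → I) :
    partEntropy ν (fun y => e (p y)) = partEntropy ν p := by
  rw [partEntropy_eq_sum_real, partEntropy_eq_sum_real, ← e.sum_comp]
  refine Finset.sum_congr rfl fun i _ => ?_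
  congr 2
  ext y
  simp

theorem partEntropy_map {Z : Type*} [MeasurableSpace Z] (ν : Measure Y) {f : Y → Z}
    (hf : Measurable f) {p : Z → I} (hp : ∀ i, MeasurableSet (p ⁻¹' {i})) :
    partEntropy (ν.map f) p = partEntropy ν (fun y => p (f y)) := by
  refine Finset.sum_congr rfl fun i _ => ?_
  rw [Measure.map_apply hf (hp i)]
  rfl

theorem negMulLog_sum_le {ι : Type*} (s : Finset ι) (a : ι → ℝ) (ha : ∀ i ∈ s, 0 ≤ a i) :
    Real.negMulLog (∑ i ∈ s, a i) ≤ ∑ i ∈ s, Real.negMulLog (a i) := by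
  simp only [Real.negMulLog_eq_neg, Finset.sum_mul, Finset.sum_neg_distrib]
  refine neg_le_neg (Finset.sum_le_sum fun i hi => ?_)
  rcases (ha i hi).eq_or_lt with h | h
  · simp [← h]
  · exact mul_le_mul_of_nonneg_left
      (Real.log_le_log h (Finset.single_le_sum ha hi)) h.le

theorem partEntropy_nonneg (ν : Measure Y) [IsProbabilityMeasure ν] (p : Y → I) :
    0 ≤ partEntropy ν p :=
  Finset.sum_nonneg fun _ _ => Real.negMulLog_nonneg measureReal_nonneg measureReal_le_one

/-- The entropy of a partition does not increase when atoms are merged. -/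
theorem partEntropy_comp_le (ν : Measure Y) [IsProbabilityMeasure ν] {p : Y → I}
    (hp : ∀ i, MeasurableSet (p ⁻¹' {i})) (f : I → J) :
    partEntropy ν (fun y => f (p y)) ≤ partEntropy ν p := by
  rw [partEntropy_eq_sum_real, partEntropy_eq_sum_real,
    ← Finset.sum_fiberwise Finset.univ f fun i => Real.negMulLog (ν.real (p ⁻¹' {i}))]
  refine Finset.sum_le_sum fun j _ => ?_
  refine le_trans (le_of_eq ?_) (negMulLog_sum_le _ _ fun i _ => measureReal_nonneg)
  congr 1
  rw [← measureReal_biUnion_finset]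
  · congr 1
    ext y
    simp
  · intro i _ i' _ hne
    exact (disjoint_singleton.2 hne).preimage p
  · exact fun i _ => hp i

variable [MeasurableSpace J] [MeasurableSingletonClass J]

theorem integral_comp_eq_sum (ν : Measure Y) [IsFiniteMeasure ν] {q : Y → J}
    (hq : Measurable q) (G : J → ℝ) :
    ∫ y, G (q y) ∂ν = ∑ j, ν.real (q ⁻¹' {j}) * G j := by
  rw [← integral_map (φ := q) (f := G) hq.aemeasurable
    (measurable_of_finite G).aestronglyMeasurable, integral_fintype .of_finite]
  refine Finset.sum_congr rfl fun j _ => ?_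
  rw [map_measureReal_apply hq (measurableSet_singleton j), smul_eq_mul]

variable [MeasurableSpace I] [MeasurableSingletonClass I]

theorem sum_real_inter (ν : Measure Y) [IsFiniteMeasure ν] {p : Y → I} (hp : Measurable p)
    (s : Set Y) : ∑ i, ν.real (p ⁻¹' {i} ∩ s) = ν.real s := by
  have h := sum_measureReal_preimage_singleton (μ := ν.restrict s) (f := p) Finset.univ
    fun i _ => hp (measurableSet_singleton i)
  simpa [measureReal_restrict_apply (hp (measurableSet_singleton _))] using h

/-- The chain rule for the entropy of a joint partition. -/
theorem partEntropy_prod (ν : Measure Y) [IsFiniteMeasure ν] {p : Y → I} {q : Y → J}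
    (hp : Measurable p) (hq : Measurable q) :
    partEntropy ν (fun y => (p y, q y)) =
      partEntropy ν q + ∫ y, ∑ i, Real.negMulLog (condFreq ν p q i (q y)) ∂ν := by
  rw [integral_comp_eq_sum ν hq fun j => ∑ i, Real.negMulLog (condFreq ν p q i j),
    partEntropy_eq_sum_real, partEntropy_eq_sum_real, Fintype.sum_prod_type_right,
    ← Finset.sum_add_distrib]
  refine Finset.sum_congr rfl fun j _ => ?_
  have key : ∀ i, Real.negMulLog (ν.real ((fun y => (p y, q y)) ⁻¹' {(i, j)})) =
      ν.real (q ⁻¹' {j}) * Real.negMulLog (condFreq ν p q i j)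
        - ν.real (p ⁻¹' {i} ∩ q ⁻¹' {j}) * Real.log (ν.real (q ⁻¹' {j})) := by
    intro i
    have : (fun y => (p y, q y)) ⁻¹' {(i, j)} = p ⁻¹' {i} ∩ q ⁻¹' {j} := by
      ext y; simp
    rw [this, ← real_mul_condFreq ν p q i j, Real.negMulLog_mul, Real.negMulLog_eq_neg]
    ring
  simp only [key]
  rw [Finset.sum_sub_distrib, ← Finset.sum_mul, sum_real_inter ν hp, Finset.mul_sum,
    Real.negMulLog_eq_neg]
  ring

end FinitePartitions

theorem condExp_indicator_comap {Y I J : Type*} [MeasurableSpace Y] [MeasurableSpace I]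
    [MeasurableSingletonClass I] [Fintype J] [MeasurableSpace J] [MeasurableSingletonClass J]
    (ν : Measure Y) [IsFiniteMeasure ν] {p : Y → I} {q : Y → J}
    (hp : Measurable p) (hq : Measurable q) (i : I) :
    (fun y => condFreq ν p q i (q y)) =ᵐ[ν]
      ν[(p ⁻¹' {i}).indicator fun _ => (1 : ℝ) | MeasurableSpace.comap q inferInstance] := by
  have hpi : MeasurableSet (p ⁻¹' {i}) := hp (measurableSet_singleton i)
  have hint : Integrable (fun y => condFreq ν p q i (q y)) ν :=
    .of_bound ((measurable_of_finite (condFreq ν p q i)).comp hq).aestronglyMeasurable 1 <|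
      .of_forall fun y => by
        simpa [abs_of_nonneg (condFreq_nonneg ν p q i (q y))] using
          condFreq_le_one ν p q i (q y)
  refine ae_eq_condExp_of_forall_setIntegral_eq hq.comap_le
    ((integrable_const _).indicator hpi) (fun _ _ _ => hint.integrableOn) ?_ ?_
  · rintro _ ⟨S, hS, rfl⟩ -
    rw [← integral_indicator (hq hS), ← integral_indicator (hq hS), indicator_indicator,
      integral_indicator_const _ ((hq hS).inter hpi)]
    have h1 : (q ⁻¹' S).indicator (fun y => condFreq ν p q i (q y)) =
        fun y => S.indicator (condFreq ν p q i) (q y) := rfl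
    rw [h1, integral_comp_eq_sum ν hq, smul_eq_mul, mul_one, ← sum_real_inter ν hq]
    refine Finset.sum_congr rfl fun j _ => ?_
    by_cases hj : j ∈ S
    · rw [indicator_of_mem hj, real_mul_condFreq]
      congr 1
      ext y
      simp only [mem_inter_iff, mem_preimage, mem_singleton_iff]
      constructor
      · rintro ⟨h, rfl⟩; exact ⟨rfl, hj, h⟩
      · rintro ⟨rfl, -, h⟩; exact ⟨h, rfl⟩
    · rw [indicator_of_notMem hj, mul_zero]
      have : q ⁻¹' {j} ∩ (q ⁻¹' S ∩ p ⁻¹' {i}) = ∅ := by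
        ext y
        simp only [mem_inter_iff, mem_preimage, mem_singleton_iff, mem_empty_iff_false, iff_false]
        rintro ⟨rfl, h, -⟩
        exact hj h
      rw [this, measureReal_empty]
  · exact ((measurable_of_finite (condFreq ν p q i)).comp (comap_measurable q)).aestronglyMeasurable

section Generator

variable {Y I : Type*}

/-- The first `n` symbols of the itinerary of `y` under `g` with respect to `η`. -/
def itinerary (g : Y → Y) (η : Y → I) (n : ℕ) (y : Y) : Fin n → I := fun i => η (g^[i.val] y)

theorem itinerary_succ (g : Y → Y) (η : Y → I) (n : ℕ) (y : Y) :
    itinerary g η (n + 1) y = Fin.cons (η y) (itinerary g η n (g y)) := by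
  funext i
  refine Fin.cases ?_ (fun i => ?_) i
  · simp [itinerary]
  · simp [itinerary]

variable [MeasurableSpace I]

theorem iSup_comap_itinerary (g : Y → Y) (η : Y → I) :
    ⨆ n, MeasurableSpace.comap (itinerary g η n) MeasurableSpace.pi =
      MeasurableSpace.comap (fun y (k : ℕ) => η (g^[k] y)) MeasurableSpace.pi := by
  simp only [MeasurableSpace.pi, MeasurableSpace.comap_iSup, MeasurableSpace.comap_comp]
  refine le_antisymm (iSup_le fun n => iSup_le fun i => ?_) (iSup_le fun k => ?_)
  · exact le_iSup (fun k : ℕ => MeasurableSpace.comap (fun y => η (g^[k] y)) _) i.val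
  · exact le_iSup_of_le (k + 1) (le_iSup_of_le (Fin.last k) le_rfl)

variable [mY : MeasurableSpace Y]

theorem measurable_itinerary {g : Y → Y} (hg : Measurable g) {η : Y → I} (hη : Measurable η)
    (n : ℕ) : Measurable (itinerary g η n) :=
  measurable_pi_lambda _ fun i => hη.comp (hg.iterate i.val)

variable [Fintype I] [MeasurableSingletonClass I]

/-- If the itineraries generate the σ-algebra, then the entropy rate of a finite partition
equals its conditional entropy given the past. -/
theorem tendsto_partEntropy_itinerary (ν : Measure Y) [IsProbabilityMeasure ν] {g : Y → Y}
    (hg : MeasurePreserving g ν ν) {η : Y → I} (hη : Measurable η)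
    (hgen : MeasurableSpace.comap (fun y (k : ℕ) => η (g^[k] y)) MeasurableSpace.pi = mY) :
    Tendsto (fun n : ℕ => (n : ℝ)⁻¹ * partEntropy ν (itinerary g η n)) atTop
      (𝓝 (∫ y, ∑ i, Real.negMulLog
        ((ν[(η ⁻¹' {i}).indicator fun _ => (1 : ℝ) | MeasurableSpace.comap g mY]) y) ∂ν)) := by
  have hc := measurable_itinerary hg.measurable hη
  let q : (n : ℕ) → Y → Fin n → I := fun n y => itinerary g η n (g y)
  have hq : ∀ n, Measurable (q n) := fun n => (hc n).comp hg.measurable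
  let F : ℕ → Y → ℝ := fun n y => ∑ i, Real.negMulLog (condFreq ν η (q n) i (q n y))
  have hstep : ∀ n, partEntropy ν (itinerary g η (n + 1)) =
      partEntropy ν (itinerary g η n) + ∫ y, F n y ∂ν := by
    intro n
    have h1 : itinerary g η (n + 1) = fun y => Fin.consEquiv (fun _ => I) (η y, q n y) :=
      funext fun y => itinerary_succ g η n y
    rw [h1, partEntropy_equiv, partEntropy_prod ν hη (hq n)]
    congr 1
    conv_rhs => rw [← hg.map_eq]
    rw [partEntropy_map ν hg.measurable fun i => hc n (measurableSet_singleton i)]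
  have hsum : ∀ n, partEntropy ν (itinerary g η n) =
      ∑ k ∈ Finset.range n, ∫ y, F k y ∂ν := by
    intro n
    induction n with
    | zero =>
      have : itinerary g η 0 ⁻¹' {default} = univ := by
        ext y; simpa using Subsingleton.elim _ _
      rw [partEntropy_eq_sum_real, Fintype.sum_unique, this]
      simp
    | succ n ih => rw [hstep, ih, Finset.sum_range_succ]
  simp only [hsum]
  refine Tendsto.cesaro ?_
  let 𝓖 : Filtration ℕ mY :=
    { seq := fun n => MeasurableSpace.comap (q n) MeasurableSpace.pi
      mono' := by
        refine monotone_nat_of_le_succ fun n => ?_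
        have h : q n = (fun (w : Fin (n + 1) → I) (i : Fin n) => w i.castSucc) ∘ q (n + 1) := rfl
        rw [h, ← MeasurableSpace.comap_comp]
        exact MeasurableSpace.comap_mono
          (measurable_pi_lambda _ fun i => measurable_pi_apply _).comap_le
      le' := fun n => (hq n).comap_le }
  have hsup : ⨆ n, 𝓖 n = MeasurableSpace.comap g mY := by
    have h : ∀ n, 𝓖 n = MeasurableSpace.comap g
        (MeasurableSpace.comap (itinerary g η n) MeasurableSpace.pi) :=
      fun n => (MeasurableSpace.comap_comp (f := itinerary g η n) (g := g)).symm
    simp only [h]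
    rw [← MeasurableSpace.comap_iSup, iSup_comap_itinerary, hgen]
  refine tendsto_integral_of_dominated_convergence (fun _ => (Fintype.card I : ℝ)) ?_
    (integrable_const _) ?_ ?_
  · exact fun n => ((measurable_of_finite fun w =>
      ∑ i, Real.negMulLog (condFreq ν η (q n) i w)).comp (hq n)).aestronglyMeasurable
  · refine fun n => .of_forall fun y => ?_
    refine (norm_sum_le _ _).trans ?_
    refine (Finset.sum_le_sum (g := fun _ : I => (1 : ℝ)) fun i _ => ?_).trans_eq
      (by simp)
    have h0 := condFreq_nonneg ν η (q n) i (q n y)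
    have h1 := condFreq_le_one ν η (q n) i (q n y)
    rw [Real.norm_of_nonneg (Real.negMulLog_nonneg h0 h1)]
    linarith [Real.negMulLog_le_one_sub_self h0]
  · have hae : ∀ i, ∀ᵐ y ∂ν, Tendsto (fun n => condFreq ν η (q n) i (q n y)) atTop
        (𝓝 ((ν[(η ⁻¹' {i}).indicator fun _ => (1 : ℝ) | MeasurableSpace.comap g mY]) y)) := by
      intro i
      have h1 := tendsto_ae_condExp (μ := ν) (ℱ := 𝓖) ((η ⁻¹' {i}).indicator fun _ => (1 : ℝ))
      rw [hsup] at h1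
      have h2 := ae_all_iff.2 fun n => condExp_indicator_comap ν hη (hq n) i
      filter_upwards [h1, h2] with y hy1 hy2
      exact hy1.congr fun n => (hy2 n).symm
    filter_upwards [ae_all_iff.2 hae] with y hy
    exact tendsto_finsetSum _ fun i _ => (Real.continuous_negMulLog.tendsto _).comp (hy i)

end Generator

/-- If `f` is injective on a set of full measure and takes finitely many values, then the
entropy of the measure is the entropy of the partition into the fibers of `f`. -/
theorem atomEntropy_eq_ofReal_sum {X I : Type*} [MeasurableSpace X] [MeasurableSingletonClass X]
    [Fintype I] (ρ : Measure X) [IsProbabilityMeasure ρ] {F : Set X} (hF : ρ F = 1)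
    {f : X → I} (hinj : InjOn f F) :
    atomEntropy ρ = ENNReal.ofReal (∑ i, Real.negMulLog (ρ.real (f ⁻¹' {i}))) := by
  have hfin : F.Finite := Set.Finite.of_injOn (mapsTo_univ f F) hinj Set.finite_univ
  have hFc : ρ Fᶜ = 0 := (prob_compl_eq_zero_iff hfin.measurableSet).2 hF
  have hae : ∀ᵐ x ∂ρ, x ∈ F := hFc
  have hpt : ∀ y ∈ F, ρ.real {y} = ρ.real (f ⁻¹' {f y}) := by
    intro y hy
    refine measureReal_congr ?_
    filter_upwards [hae] with x hx
    exact propext ⟨fun h => congrArg f h, fun h => hinj hx hy h⟩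
  rw [atomEntropy, if_pos ⟨F, hfin.countable, hfin.measurableSet, hF⟩,
    tsum_eq_sum (s := hfin.toFinset), ← ENNReal.ofReal_sum_of_nonneg]
  · congr 1
    rw [← Finset.sum_subset (Finset.subset_univ (hfin.toFinset.image f)),
      Finset.sum_image (by simpa using hinj)]
    · exact Finset.sum_congr rfl fun y hy => congrArg _ (hpt y (by simpa using hy))
    · intro i _ hi
      have h0 : ρ (f ⁻¹' {i}) = 0 := measure_mono_null (t := Fᶜ) (fun x hx hxF => hi <|
        Finset.mem_image.2 ⟨x, hfin.mem_toFinset.2 hxF, hx⟩) hFc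
      simp [measureReal_def, h0]
  · exact fun _ _ => Real.negMulLog_nonneg measureReal_nonneg measureReal_le_one
  · intro y hy
    have h0 : ρ {y} = 0 := measure_mono_null (by simpa using hy) hFc
    simp [h0]

section OrbitSpace

variable {X : Type*} {T : X → Set X}

theorem iterate_shiftOrb_zero (k : ℕ) (y : orbitSpace T) :
    ((shiftOrb T)^[k] y).1 0 = y.1 k := by
  induction k generalizing y with
  | zero => rfl
  | succ k ih => rw [Function.iterate_succ_apply, ih]; rfl

/-- An orbit as the pair of its initial point and its shift. -/
def headTail (T : X → Set X) (y : orbitSpace T) : X × (ℕ → X) := (y.1 0, shiftSeq y.1)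

theorem headTail_injective (T : X → Set X) : Function.Injective (headTail T) := by
  intro y y' h
  refine Subtype.ext (funext fun k => ?_)
  cases k with
  | zero => exact congrArg Prod.fst h
  | succ k => exact congrFun (congrArg Prod.snd h) k

theorem exists_headTail_eq {a : X} {x : orbitSpace T} (h : x.1 0 ∈ T a) :
    ∃ y : orbitSpace T, headTail T y = (a, x.1) :=
  ⟨⟨fun k => Nat.casesOn k a x.1, fun k => by
    cases k with
    | zero => exact h
    | succ k => exact x.2 k⟩, rfl⟩

variable [MeasurableSpace X]

theorem measurable_shiftSeq : Measurable (shiftSeq : (ℕ → X) → ℕ → X) :=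
  measurable_pi_lambda _ fun k => measurable_pi_apply (k + 1)

theorem measurable_shiftOrb (T : X → Set X) : Measurable (shiftOrb T) :=
  (measurable_shiftSeq.comp measurable_subtype_coe).subtype_mk

theorem measurableSet_orbitSpace (hT : MeasurableSet (graph2 T)) :
    MeasurableSet (orbitSpace T) := by
  have : orbitSpace T = ⋂ k : ℕ, (fun x : ℕ → X => (x k, x (k + 1))) ⁻¹' graph2 T := by
    ext x; simp [orbitSpace, graph2]
  rw [this]
  exact .iInter fun k => ((measurable_pi_apply k).prodMk (measurable_pi_apply (k + 1))) hT

theorem measurable_headTail (T : X → Set X) : Measurable (headTail T) :=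
  ((measurable_pi_apply 0).comp measurable_subtype_coe).prodMk
    (measurable_shiftSeq.comp measurable_subtype_coe)

theorem measurable_measure_section {Z : Type*} [MeasurableSpace Z] {P : Z → Measure X}
    (hP : Measurable P) (hprob : ∀ z, IsProbabilityMeasure (P z)) {C : Set (X × Z)}
    (hC : MeasurableSet C) : Measurable fun z => P z {a | (a, z) ∈ C} := by
  let κ : ProbabilityTheory.Kernel Z X := ⟨P, hP⟩
  have : ProbabilityTheory.IsMarkovKernel κ := ⟨hprob⟩
  exact ProbabilityTheory.Kernel.measurable_kernel_prodMk_left (κ := κ) (measurable_swap hC)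

variable {ν : Measure (orbitSpace T)} {P : (ℕ → X) → Measure X}
  {M : Set (X × (ℕ → X))}

theorem measure_headTail_preimage (hinv : ν.map (shiftOrb T) = ν)
    (hP : IsBackwardCondKernel ((ν.map (Subtype.val : orbitSpace T → ℕ → X)).map
      fun x : ℕ → X => (x 0, shiftSeq x)) M P)
    {C : Set (X × (ℕ → X))} (hC : MeasurableSet C) :
    ν (headTail T ⁻¹' C) = ∫⁻ y, P y.1 {a | (a, y.1) ∈ C} ∂ν := by
  obtain ⟨hPm, hprob, -, h⟩ := hP
  have hmap : (ν.map (Subtype.val : orbitSpace T → ℕ → X)).map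
      (fun x : ℕ → X => (x 0, shiftSeq x)) = ν.map (headTail T) :=
    Measure.map_map ((measurable_pi_apply 0).prodMk measurable_shiftSeq) measurable_subtype_coe
  have hsnd : (ν.map (headTail T)).map Prod.snd = ν.map Subtype.val := by
    rw [Measure.map_map measurable_snd (measurable_headTail T)]
    conv_rhs => rw [← hinv, Measure.map_map measurable_subtype_coe (measurable_shiftOrb T)]
    rfl
  have := h C hC
  rwa [hmap, Measure.map_apply (measurable_headTail T) hC, hsnd,
    lintegral_map (measurable_measure_section hPm hprob hC) measurable_subtype_coe] at this

/-- The backward kernel computes conditional probabilities given the shift. -/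
theorem condExp_indicator_comap_shiftOrb [IsProbabilityMeasure ν]
    (hinv : ν.map (shiftOrb T) = ν)
    (hP : IsBackwardCondKernel ((ν.map (Subtype.val : orbitSpace T → ℕ → X)).map
      fun x : ℕ → X => (x 0, shiftSeq x)) M P)
    {C : Set (X × (ℕ → X))} (hC : MeasurableSet C) :
    (fun y => (P (shiftOrb T y).1).real {a | (a, (shiftOrb T y).1) ∈ C}) =ᵐ[ν]
      ν[(headTail T ⁻¹' C).indicator fun _ => (1 : ℝ) |
        MeasurableSpace.comap (shiftOrb T) inferInstance] := by
  obtain ⟨hPm, hprob, -⟩ := id hP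
  have hσ := measurable_shiftOrb T
  have hCm : MeasurableSet (headTail T ⁻¹' C) := measurable_headTail T hC
  let φ : orbitSpace T → ℝ := fun y => (P y.1).real {a | (a, y.1) ∈ C}
  have hφ : Measurable φ :=
    ((measurable_measure_section hPm hprob hC).comp measurable_subtype_coe).ennreal_toReal
  have hint : Integrable (fun y => φ (shiftOrb T y)) ν :=
    .of_bound (hφ.comp hσ).aestronglyMeasurable 1 <| .of_forall fun y => by
      rw [Real.norm_of_nonneg measureReal_nonneg]
      exact measureReal_le_one
  refine ae_eq_condExp_of_forall_setIntegral_eq hσ.comap_le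
    ((integrable_const _).indicator hCm) (fun _ _ _ => hint.integrableOn) ?_
    (hφ.comp (comap_measurable _)).aestronglyMeasurable
  rintro _ ⟨_, ⟨B, hB, rfl⟩, rfl⟩ -
  have hB' : MeasurableSet (Subtype.val ⁻¹' B : Set (orbitSpace T)) := measurable_subtype_coe hB
  rw [← integral_indicator (hσ hB'), ← integral_indicator (hσ hB'), indicator_indicator,
    integral_indicator_const _ ((hσ hB').inter hCm), smul_eq_mul, mul_one]
  change ∫ y, (Subtype.val ⁻¹' B).indicator φ (shiftOrb T y) ∂ν = _
  have h2 : ∀ y : orbitSpace T, (Subtype.val ⁻¹' B).indicator φ y =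
      (P y.1 {a | (a, y.1) ∈ C ∩ Prod.snd ⁻¹' B}).toReal := by
    intro y
    by_cases hy : y.1 ∈ B
    · rw [indicator_of_mem (show y ∈ Subtype.val ⁻¹' B from hy)]
      simp [φ, hy, measureReal_def]
    · rw [indicator_of_notMem (show y ∉ Subtype.val ⁻¹' B from hy)]
      simp [hy]
  have hCB : MeasurableSet (C ∩ Prod.snd ⁻¹' B) := hC.inter (measurable_snd hB)
  rw [← integral_map (φ := shiftOrb T) (f := (Subtype.val ⁻¹' B).indicator φ) hσ.aemeasurable
    (hφ.indicator hB').aestronglyMeasurable, hinv]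
  simp only [h2]
  have hm : Measurable fun y : orbitSpace T => P y.1 {a | (a, y.1) ∈ C ∩ Prod.snd ⁻¹' B} :=
    (measurable_measure_section hPm hprob hCB).comp measurable_subtype_coe
  rw [integral_toReal hm.aemeasurable (.of_forall fun y => measure_lt_top _ _),
    ← measure_headTail_preimage hinv hP hCB, inter_comm]
  rfl

theorem ae_measure_fiber_eq_one (hT : MeasurableSet (graph2 T))
    (hinv : ν.map (shiftOrb T) = ν)
    (hP : IsBackwardCondKernel ((ν.map (Subtype.val : orbitSpace T → ℕ → X)).map
      fun x : ℕ → X => (x 0, shiftSeq x)) M P) :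
    ∀ᵐ y ∂ν, P y.1 {a | y.1 0 ∈ T a} = 1 := by
  have hm : Measurable fun q : X × (ℕ → X) => (q.1, q.2 0) :=
    measurable_fst.prodMk ((measurable_pi_apply 0).comp measurable_snd)
  have hM : MeasurableSet {q : X × (ℕ → X) | q.2 0 ∈ T q.1} := hm hT
  have h := measure_headTail_preimage hinv hP hM.compl
  have h0 : headTail T ⁻¹' {q : X × (ℕ → X) | q.2 0 ∈ T q.1}ᶜ = ∅ :=
    eq_empty_of_forall_notMem fun y hy => hy (y.2 0)
  have hsec : Measurable fun y : orbitSpace T =>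
      P y.1 {a | (a, y.1) ∈ {q : X × (ℕ → X) | q.2 0 ∈ T q.1}ᶜ} :=
    (measurable_measure_section hP.1 hP.2.1 hM.compl).comp measurable_subtype_coe
  rw [h0, measure_empty, eq_comm, lintegral_eq_zero_iff hsec] at h
  filter_upwards [h] with y hy
  have := hP.2.1 y.1
  exact (prob_compl_eq_zero_iff (measurable_prodMk_right hM)).1 hy

end OrbitSpace

section Expansive

variable {X : Type*} [MetricSpace X] [CompactSpace X] [MeasurableSpace X] [BorelSpace X]
  {T : X → Set X}

/-- The entropy rate of a partition of the orbit space that distinguishes orbits with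
`ε`-distant initial points is the mean entropy of the backward kernel. -/
theorem exists_tendsto_partEntropy_itinerary (hT : IsCorrespondence T) {ε : ℝ}
    (hexp : IsFwdExpansiveWith T ε) {ν : Measure (orbitSpace T)} [IsProbabilityMeasure ν]
    (hinv : ν.map (shiftOrb T) = ν) {P : (ℕ → X) → Measure X} {M : Set (X × (ℕ → X))}
    (hP : IsBackwardCondKernel ((ν.map (Subtype.val : orbitSpace T → ℕ → X)).map
      fun x : ℕ → X => (x 0, shiftSeq x)) M P)
    {I : Type*} [Fintype I] [MeasurableSpace I] [MeasurableSingletonClass I]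
    {η : orbitSpace T → I} (hη : Measurable η)
    (hsep : ∀ y y', η y = η y' → dist (y.1 0) (y'.1 0) ≤ ε) :
    ∃ L : ℝ, 0 ≤ L ∧ ∫⁻ y, atomEntropy (P y.1) ∂ν = ENNReal.ofReal L ∧
      Tendsto (fun n : ℕ => (n : ℝ)⁻¹ * partEntropy ν (itinerary (shiftOrb T) η n))
        atTop (𝓝 L) := by
  have hgraph : MeasurableSet (graph2 T) := hT.2.2.measurableSet
  have : StandardBorelSpace (orbitSpace T) := (measurableSet_orbitSpace hgraph).standardBorel
  have hσ := measurable_shiftOrb T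
  have hmp : MeasurePreserving (shiftOrb T) ν ν := ⟨hσ, hinv⟩
  have hgen : MeasurableSpace.comap (fun y (k : ℕ) => η ((shiftOrb T)^[k] y))
      MeasurableSpace.pi = inferInstanceAs (MeasurableSpace (orbitSpace T)) := by
    refine (Measurable.measurableEmbedding
      (measurable_pi_lambda _ fun k => hη.comp (hσ.iterate k)) fun y y' h => ?_).comap_eq
    by_contra hne
    obtain ⟨n, hn⟩ := hexp.2 y.1 y.2 y'.1 y'.2 fun h => hne (Subtype.ext h)
    have := hsep _ _ (congrFun h n)
    rw [iterate_shiftOrb_zero, iterate_shiftOrb_zero] at this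
    exact this.not_gt hn
  obtain ⟨y₀⟩ : Nonempty (orbitSpace T) := nonempty_of_isProbabilityMeasure ν
  obtain ⟨η', hη', h_ext⟩ := ((measurable_headTail T).measurableEmbedding
    (headTail_injective T)).exists_measurable_extend hη fun _ => ⟨η y₀⟩
  have hC : ∀ i, MeasurableSet (η' ⁻¹' {i}) := fun i => hη' (measurableSet_singleton i)
  let Φ : orbitSpace T → ℝ := fun y =>
    ∑ i, Real.negMulLog ((P y.1).real {a | (a, y.1) ∈ η' ⁻¹' {i}})
  have hterm : ∀ y : orbitSpace T, ∀ i,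
      0 ≤ Real.negMulLog ((P y.1).real {a | (a, y.1) ∈ η' ⁻¹' {i}}) := fun y i =>
    have := hP.2.1 y.1
    Real.negMulLog_nonneg measureReal_nonneg measureReal_le_one
  have hΦ0 : ∀ y, 0 ≤ Φ y := fun y => Finset.sum_nonneg fun i _ => hterm y i
  have hΦm : Measurable Φ := Finset.measurable_sum _ fun i _ =>
    Real.continuous_negMulLog.measurable.comp ((measurable_measure_section hP.1 hP.2.1
      (hC i)).comp measurable_subtype_coe).ennreal_toReal
  have hΦint : Integrable Φ ν := by
    refine .of_bound hΦm.aestronglyMeasurable (Fintype.card I : ℝ) (.of_forall fun y => ?_)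
    rw [Real.norm_of_nonneg (hΦ0 y)]
    refine (Finset.sum_le_sum (g := fun _ : I => (1 : ℝ)) fun i _ => ?_).trans_eq (by simp)
    have h0 : 0 ≤ (P y.1).real {a | (a, y.1) ∈ η' ⁻¹' {i}} := measureReal_nonneg
    linarith [Real.negMulLog_le_one_sub_self h0]
  refine ⟨∫ y, Φ y ∂ν, integral_nonneg hΦ0, ?_, ?_⟩
  · rw [ofReal_integral_eq_lintegral_ofReal hΦint (.of_forall hΦ0)]
    refine lintegral_congr_ae ?_
    filter_upwards [ae_measure_fiber_eq_one hgraph hinv hP] with y hy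
    have := hP.2.1 y.1
    refine atomEntropy_eq_ofReal_sum (P y.1) hy (f := fun a => η' (a, y.1)) ?_
    intro a ha b hb hab
    obtain ⟨u, hu⟩ := exists_headTail_eq ha
    obtain ⟨v, hv⟩ := exists_headTail_eq hb
    have huv : η u = η v := by
      rw [← h_ext, Function.comp_apply, Function.comp_apply, hu, hv]
      exact hab
    have h0 := hsep u v huv
    suffices u = v by
      rw [this, hv] at hu
      exact (congrArg Prod.fst hu).symm
    by_contra hne
    obtain ⟨n, hn⟩ := hexp.2 u.1 u.2 v.1 v.2 fun h => hne (Subtype.ext h)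
    cases n with
    | zero => exact h0.not_gt hn
    | succ n =>
      have : u.1 (n + 1) = v.1 (n + 1) :=
        (congrFun (congrArg Prod.snd hu) n).trans (congrFun (congrArg Prod.snd hv) n).symm
      rw [this, dist_self] at hn
      exact hexp.1.not_gt hn
  · convert tendsto_partEntropy_itinerary ν hmp hη hgen using 2
    have h1 : ∫ y, Φ y ∂ν = ∫ y, Φ (shiftOrb T y) ∂ν := by
      conv_lhs => rw [← hinv]
      exact integral_map hσ.aemeasurable hΦm.aestronglyMeasurable
    rw [h1]
    refine integral_congr_ae ?_
    filter_upwards [ae_all_iff.2 fun i => condExp_indicator_comap_shiftOrb hinv hP (hC i)]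
      with y hy
    refine Finset.sum_congr rfl fun i _ => ?_
    rw [hy i, ← preimage_comp, h_ext]

/-- A compact metric space has a finite measurable partition into sets of small diameter. -/
theorem exists_measurable_fin_dist_le {ε : ℝ} (hε : 0 < ε) :
    ∃ (N : ℕ) (A : X → Fin N), Measurable A ∧ ∀ x y, A x = A y → dist x y ≤ ε := by
  obtain ⟨t, -, ht⟩ := isCompact_univ.elim_nhds_subcover (fun x : X => Metric.ball x (ε / 2))
    fun x _ => Metric.ball_mem_nhds x (half_pos hε)
  let B : X → t → Prop := fun x c => x ∈ Metric.ball c.1 (ε / 2)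
  have hB : Measurable B :=
    measurable_pi_lambda _ fun c => measurableSet_setOfPred.1 Metric.isOpen_ball.measurableSet
  refine ⟨_, fun x => Fintype.equivFin (t → Prop) (B x), (measurable_of_finite _).comp hB, ?_⟩
  intro x y hxy
  have h := (Fintype.equivFin (t → Prop)).injective hxy
  obtain ⟨c, hc, hxc⟩ := mem_iUnion₂.1 (ht (mem_univ x))
  have hyc : y ∈ Metric.ball c (ε / 2) := (congrFun h ⟨c, hc⟩).mp hxc
  rw [Metric.mem_ball] at hxc hyc
  linarith [dist_triangle_right x y c]

end Expansive

/-- **Rokhlin formula for the shift on the orbit space.** For a forward expansive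
correspondence `T`, a `σ`-invariant Borel probability measure `ν` on `O_ω(T)`, and a
backward conditional transition probability kernel `𝒫` of `ν̂` from `X^ℕ` to `X`
supported on `O₂(T) × X^ℕ` (with `X^ℕ ≃ X × X^ℕ`, `x ↦ (x 0, shift x)`), one has
`h_ν(σ) = ∫_{O_ω(T)} H(𝒫_x) dν(x)`. -/
theorem rokhlin_shift
    {X : Type*} [MetricSpace X] [CompactSpace X] [MeasurableSpace X] [BorelSpace X]
    (T : X → Set X) (hT : IsCorrespondence T) (hexp : IsFwdExpansive T)
    (ν : Measure ↥(orbitSpace T)) (hν : IsProbabilityMeasure ν)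
    (hinv : ν.map (shiftOrb T) = ν)
    (P : (ℕ → X) → Measure X)
    (hP : IsBackwardCondKernel
      ((ν.map (Subtype.val : ↥(orbitSpace T) → ℕ → X)).map fun x : ℕ → X =>
        (x 0, shiftSeq x))
      {q : X × (ℕ → X) | q.2 0 ∈ T q.1} P) :
    ksEntropy ν (shiftOrb T) = ((∫⁻ x, atomEntropy (P x.1) ∂ν : ℝ≥0∞) : EReal) := by
  obtain ⟨ε, hε⟩ := hexp
  obtain ⟨N, A, hA, hAdist⟩ := exists_measurable_fin_dist_le (X := X) hε.1
  let α : orbitSpace T → Fin N := fun y => A (y.1 0)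
  have hα : Measurable α := hA.comp ((measurable_pi_apply 0).comp measurable_subtype_coe)
  obtain ⟨L, hL0, hL, hLα⟩ := exists_tendsto_partEntropy_itinerary hT hε hinv hP hα
    fun y y' h => hAdist _ _ h
  rw [hL, EReal.coe_ennreal_ofReal, max_eq_left hL0]
  refine le_antisymm (iSup_le fun m => iSup_le fun p => iSup_le fun hp => ?_) ?_
  · obtain ⟨L', hL0', hL', hLη⟩ := exists_tendsto_partEntropy_itinerary hT hε hinv hP
      (hp.prodMk hα) fun y y' h => hAdist _ _ (congrArg Prod.snd h)
    have hLL : L' = L := (ENNReal.ofReal_eq_ofReal_iff hL0' hL0).1 (hL'.symm.trans hL)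
    rw [EReal.coe_le_coe_iff, ← hLL, ← hLη.limsup_eq]
    refine limsup_le_limsup (.of_forall fun n => ?_) ?_ hLη.isBoundedUnder_le
    · refine mul_le_mul_of_nonneg_left ?_ (by positivity)
      exact partEntropy_comp_le ν (p := itinerary (shiftOrb T) (fun y => (p y, α y)) n)
        (fun w => measurable_itinerary (measurable_shiftOrb T) (hp.prodMk hα) n
          (measurableSet_singleton w)) fun w i => (w i).1
    · exact IsBoundedUnder.isCoboundedUnder_le
        ⟨0, eventually_map.2 <| .of_forall fun n =>
          mul_nonneg (by positivity) (partEntropy_nonneg ν _)⟩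
  · refine le_iSup_of_le N (le_iSup_of_le α (le_iSup_of_le hα ?_))
    exact (congrArg Real.toEReal hLα.limsup_eq).ge

end Corr
end
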